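/- arXiv:2401.00749 — 2 statements merged into one kernel-verified Lean document; each statement's English description precedes it below -/
import Mathlib

section
/- Let p > −1/2 and a, b > 0. Then ∫₀^∞ y^{p−1/2} · (b+2y)^{−1/2} · exp(−√(a(b+2y))) dy = Γ(p+1/2) · Z(p,a,b)/√(2π). (This identifies the normalizing constant Z₁ of the mixing density in Proposition 1, case p > −1/2; equivalently, Z₁ = b^{p/2} √2 Γ(p+1/2) K_p(√(ab)) / (a^{p/2} √π).) -/
open Real MeasureTheory Set

/-- The (unnormalized) kernel of the GIG(p,a,b) distribution. -/
noncomputable def gigKernel (p a b x : ℝ) : ℝ :=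
  x ^ (p - 1) * Real.exp (-((a * x + b / x) / 2))

/-- The normalizing constant Z(p,a,b) of the GIG(p,a,b) distribution. -/
noncomputable def gigZ (p a b : ℝ) : ℝ :=
  ∫ x in Ioi (0 : ℝ), gigKernel p a b x

/-- The probability density function of the GIG(p,a,b) distribution. -/
noncomputable def gigPdf (p a b x : ℝ) : ℝ :=
  gigKernel p a b x / gigZ p a b

/-- The inverse Gaussian InvGauss(μ,λ) density. -/
noncomputable def invGaussPdf (μ lam x : ℝ) : ℝ :=
  Real.sqrt (lam / (2 * Real.pi * x ^ 3)) *
    Real.exp (-(lam * (x - μ) ^ 2) / (2 * μ ^ 2 * x))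

/-- The Gamma(α,β) density (shape α, rate β). -/
noncomputable def gammaPdf (α β y : ℝ) : ℝ :=
  β ^ α * y ^ (α - 1) * Real.exp (-(β * y)) / Real.Gamma α

/-- The primitive `∫₀ᵗ exp(-s²/2) ds` of the Gaussian kernel. -/
noncomputable def gaussPrimitive (t : ℝ) : ℝ :=
  ∫ s in (0 : ℝ)..t, Real.exp (-(1 / 2) * s ^ 2)

lemma hasDerivAt_gaussPrimitive (t : ℝ) :
    HasDerivAt gaussPrimitive (Real.exp (-(1 / 2) * t ^ 2)) t := by
  have hc : Continuous fun s : ℝ => Real.exp (-(1 / 2) * s ^ 2) := by fun_prop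
  exact intervalIntegral.integral_hasDerivAt_right (hc.intervalIntegrable _ _)
    (hc.stronglyMeasurableAtFilter _ _) hc.continuousAt

lemma gaussPrimitive_neg (t : ℝ) : gaussPrimitive (-t) = -gaussPrimitive t := by
  have h := intervalIntegral.integral_comp_neg (a := 0) (b := t)
    fun s : ℝ => Real.exp (-(1 / 2) * s ^ 2)
  simp only [neg_sq, neg_zero] at h
  rw [gaussPrimitive, gaussPrimitive, h, intervalIntegral.integral_symm]

lemma tendsto_gaussPrimitive_atTop :
    Filter.Tendsto gaussPrimitive Filter.atTop (nhds (√(2 * π) / 2)) := by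
  have h := intervalIntegral_tendsto_integral_Ioi 0
    (integrable_exp_neg_mul_sq (b := 1 / 2) (by norm_num)).integrableOn Filter.tendsto_id
  rwa [integral_gaussian_Ioi, show π / (1 / 2) = 2 * π by ring] at h

lemma tendsto_gaussPrimitive_atBot :
    Filter.Tendsto gaussPrimitive Filter.atBot (nhds (-(√(2 * π) / 2))) := by
  have h := (tendsto_gaussPrimitive_atTop.comp Filter.tendsto_neg_atBot_atTop).neg
  refine h.congr fun t => ?_
  simp [gaussPrimitive_neg]

/-- A primitive of `gigKernel (-1/2) (α ^ 2) (γ ^ 2)` on the positive half-line. -/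
noncomputable def gigHalfPrimitive (α γ x : ℝ) : ℝ :=
  (Real.exp (-(α * γ)) * gaussPrimitive (α * √x - γ * (√x)⁻¹) -
    Real.exp (α * γ) * gaussPrimitive (α * √x + γ * (√x)⁻¹)) / γ

lemma hasDerivAt_gigHalfPrimitive {α γ x : ℝ} (hγ : 0 < γ) (hx : 0 < x) :
    HasDerivAt (gigHalfPrimitive α γ) (gigKernel (-1 / 2) (α ^ 2) (γ ^ 2) x) x := by
  have hs : HasDerivAt (fun x => √x) (1 / (2 * √x)) x := Real.hasDerivAt_sqrt hx.ne'
  have ht : 0 < √x := Real.sqrt_pos.2 hx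
  have hi := hs.fun_inv ht.ne'
  have h1 := (hasDerivAt_gaussPrimitive _).comp x ((hs.const_mul α).sub (hi.const_mul γ))
  have h2 := (hasDerivAt_gaussPrimitive _).comp x ((hs.const_mul α).add (hi.const_mul γ))
  have h := ((h1.const_mul (Real.exp (-(α * γ)))).sub
    (h2.const_mul (Real.exp (α * γ)))).div_const γ
  refine h.congr_deriv ?_
  have hpow : x ^ (-1 / 2 - 1 : ℝ) = ((√x) ^ 3)⁻¹ := by
    rw [Real.sqrt_eq_rpow, ← Real.rpow_natCast, ← Real.rpow_mul hx.le, ← Real.rpow_neg hx.le]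
    norm_num
  have hxs : x = √x ^ 2 := (Real.sq_sqrt hx.le).symm
  rw [gigKernel, hpow]
  set t := √x
  have e1 : Real.exp (-(α * γ)) * Real.exp (-(1 / 2) * (α * t - γ * t⁻¹) ^ 2) =
      Real.exp (-((α ^ 2 * x + γ ^ 2 / x) / 2)) := by
    rw [← Real.exp_add, hxs]
    congr 1
    field_simp
    ring
  have e2 : Real.exp (α * γ) * Real.exp (-(1 / 2) * (α * t + γ * t⁻¹) ^ 2) =
      Real.exp (-((α ^ 2 * x + γ ^ 2 / x) / 2)) := by
    rw [← Real.exp_add, hxs]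
    congr 1
    field_simp
    ring
  simp only [Pi.add_apply, Pi.sub_apply]
  rw [← mul_assoc, e1, ← mul_assoc, e2]
  field_simp
  ring

lemma tendsto_gigHalfPrimitive_atTop {α : ℝ} (hα : 0 < α) (γ : ℝ) :
    Filter.Tendsto (gigHalfPrimitive α γ) Filter.atTop
      (nhds ((Real.exp (-(α * γ)) * (√(2 * π) / 2) - Real.exp (α * γ) * (√(2 * π) / 2)) / γ)) := by
  have hs := Real.tendsto_sqrt_atTop.const_mul_atTop hα
  have hi := (Real.tendsto_sqrt_atTop.inv_tendsto_atTop).const_mul γ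
  have h1 := tendsto_gaussPrimitive_atTop.comp (hs.atTop_add hi.neg)
  have h2 := tendsto_gaussPrimitive_atTop.comp (hs.atTop_add hi)
  exact ((h1.const_mul _).sub (h2.const_mul _)).div_const γ

lemma tendsto_gigHalfPrimitive_zero {γ : ℝ} (hγ : 0 < γ) (α : ℝ) :
    Filter.Tendsto (gigHalfPrimitive α γ) (nhdsWithin 0 (Ioi 0))
      (nhds ((Real.exp (-(α * γ)) * (-(√(2 * π) / 2)) -
        Real.exp (α * γ) * (√(2 * π) / 2)) / γ)) := by
  have hs0 : Filter.Tendsto (fun x => √x) (nhdsWithin 0 (Ioi 0)) (nhds 0) :=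
    (Real.continuous_sqrt.tendsto' 0 0 Real.sqrt_zero).mono_left nhdsWithin_le_nhds
  have hs := hs0.const_mul α
  have hi : Filter.Tendsto (fun x => (√x)⁻¹) (nhdsWithin 0 (Ioi 0)) Filter.atTop :=
    tendsto_inv_nhdsGT_zero.comp (tendsto_nhdsWithin_iff.2 ⟨hs0,
      Filter.eventually_of_mem self_mem_nhdsWithin fun x hx => Real.sqrt_pos.2 hx⟩)
  have hi := hi.const_mul_atTop hγ
  have h1 := tendsto_gaussPrimitive_atBot.comp
    (hs.add_atBot (Filter.tendsto_neg_atTop_atBot.comp hi))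
  have h2 := tendsto_gaussPrimitive_atTop.comp (hs.add_atTop hi)
  exact ((h1.const_mul _).sub (h2.const_mul _)).div_const γ

lemma gigKernel_nonneg (p a b : ℝ) {x : ℝ} (hx : 0 < x) : 0 ≤ gigKernel p a b x := by
  unfold gigKernel
  positivity

/-- The normalizing constant of the inverse Gaussian case `p = -1/2`. -/
lemma gigZ_neg_half {a c : ℝ} (ha : 0 < a) (hc : 0 < c) :
    gigZ (-1 / 2) a c = √(2 * π) * c ^ (-(1 / 2 : ℝ)) * Real.exp (-√(a * c)) := by
  have hα : 0 < √a := Real.sqrt_pos.2 ha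
  have hγ : 0 < √c := Real.sqrt_pos.2 hc
  have key : ∀ x ∈ Ioi (0 : ℝ), HasDerivAt (gigHalfPrimitive √a √c)
      (gigKernel (-1 / 2) a c x) x := fun x hx => by
    simpa only [Real.sq_sqrt ha.le, Real.sq_sqrt hc.le] using
      hasDerivAt_gigHalfPrimitive (α := √a) hγ hx
  set L := (Real.exp (-(√a * √c)) * (-(√(2 * π) / 2)) -
    Real.exp (√a * √c) * (√(2 * π) / 2)) / √c with hL
  have hcont : ContinuousWithinAt (Function.update (gigHalfPrimitive √a √c) 0 L) (Ici 0) 0 := by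
    rw [continuousWithinAt_update_same, Ici_sdiff_left]
    exact tendsto_gigHalfPrimitive_zero hγ _
  have hint := integral_Ioi_of_hasDerivAt_of_nonneg hcont
    (fun x hx => (key x hx).congr_of_eventuallyEq <| by
      filter_upwards [lt_mem_nhds hx] with y hy using Function.update_of_ne hy.ne' _ _)
    (fun x hx => gigKernel_nonneg (-1 / 2) a c hx)
    ((tendsto_gigHalfPrimitive_atTop hα √c).congr' <| by
      filter_upwards [Filter.eventually_gt_atTop 0] with y hy
        using (Function.update_of_ne hy.ne' _ _).symm)
  rw [gigZ, hint, Function.update_self, hL, Real.sqrt_mul ha.le, Real.rpow_neg hc.le,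
    ← Real.sqrt_eq_rpow]
  field_simp
  ring

/-- The Gamma integral turns `gigKernel p a b` into a mixture of kernels with `p = -1/2`. -/
lemma integral_rpow_mul_gigKernel_neg_half {p : ℝ} (hp : -(1 / 2 : ℝ) < p) (a b : ℝ) {x : ℝ}
    (hx : 0 < x) :
    ∫ y in Ioi (0 : ℝ), y ^ (p - 1 / 2) * gigKernel (-1 / 2) a (b + 2 * y) x =
      Real.Gamma (p + 1 / 2) * gigKernel p a b x := by
  have h := Real.integral_rpow_mul_exp_neg_mul_Ioi (a := p + 1 / 2) (r := 1 / x) (by linarith)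
    (by positivity)
  have hcongr : ∀ y : ℝ, y ^ (p - 1 / 2) * gigKernel (-1 / 2) a (b + 2 * y) x =
      gigKernel (-1 / 2) a b x * (y ^ (p + 1 / 2 - 1) * Real.exp (-(1 / x * y))) := fun y => by
    have he : Real.exp (-((a * x + (b + 2 * y) / x) / 2)) =
        Real.exp (-((a * x + b / x) / 2)) * Real.exp (-(1 / x * y)) := by
      rw [← Real.exp_add]
      congr 1
      field_simp
      ring
    rw [gigKernel, gigKernel, he, show p + 1 / 2 - 1 = p - 1 / 2 by ring]
    ring
  have hpow : x ^ (p - 1) = x ^ (-1 / 2 - 1 : ℝ) * x ^ (p + 1 / 2) := by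
    rw [← Real.rpow_add hx]
    ring_nf
  simp_rw [hcongr]
  rw [integral_const_mul, h, one_div_one_div, gigKernel, gigKernel, hpow]
  ring

lemma measurable_gigKernel_mixture (p a b : ℝ) :
    Measurable fun z : ℝ × ℝ => z.1 ^ (p - 1 / 2) * gigKernel (-1 / 2) a (b + 2 * z.1) z.2 := by
  unfold gigKernel
  fun_prop

/-- Scaling and interchanging the two integrations in the mixture of kernels with `p = -1/2`. -/
lemma integral_rpow_mul_gigZ_neg_half {p a b : ℝ} (hp : -(1 / 2 : ℝ) < p) (ha : 0 < a)
    (hb : 0 < b) :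
    ∫ y in Ioi (0 : ℝ), y ^ (p - 1 / 2) * gigZ (-1 / 2) a (b + 2 * y) =
      Real.Gamma (p + 1 / 2) * gigZ p a b := by
  have hΓ : 0 < Real.Gamma (p + 1 / 2) := Real.Gamma_pos_of_pos (by linarith)
  have hm := measurable_gigKernel_mixture p a b
  have hnn : ∀ {x y : ℝ}, 0 < x → 0 < y →
      0 ≤ y ^ (p - 1 / 2) * gigKernel (-1 / 2) a (b + 2 * y) x := fun hx hy =>
    mul_nonneg (Real.rpow_nonneg hy.le _) (gigKernel_nonneg _ _ _ hx)
  have hZ : ∀ {y : ℝ}, 0 < y → 0 < y ^ (p - 1 / 2) * gigZ (-1 / 2) a (b + 2 * y) := fun {y} hy => by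
    rw [gigZ_neg_half ha (by positivity)]
    positivity
  have hK : ∀ {x : ℝ}, 0 < x → 0 < Real.Gamma (p + 1 / 2) * gigKernel p a b x := fun hx => by
    unfold gigKernel
    positivity
  have hL : ∀ y ∈ Ioi (0 : ℝ), ENNReal.ofReal (y ^ (p - 1 / 2) * gigZ (-1 / 2) a (b + 2 * y)) =
      ∫⁻ x in Ioi (0 : ℝ),
        ENNReal.ofReal (y ^ (p - 1 / 2) * gigKernel (-1 / 2) a (b + 2 * y) x) := fun y hy => by
    have hZy := hZ hy
    rw [gigZ, ← integral_const_mul] at hZy ⊢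
    exact ofReal_integral_eq_lintegral_ofReal (.of_integral_ne_zero hZy.ne')
      ((ae_restrict_mem measurableSet_Ioi).mono fun x hx => hnn hx hy)
  have hR : ∀ x ∈ Ioi (0 : ℝ), ENNReal.ofReal (Real.Gamma (p + 1 / 2) * gigKernel p a b x) =
      ∫⁻ y in Ioi (0 : ℝ),
        ENNReal.ofReal (y ^ (p - 1 / 2) * gigKernel (-1 / 2) a (b + 2 * y) x) := fun x hx => by
    have hKx := hK hx
    rw [← integral_rpow_mul_gigKernel_neg_half hp a b hx] at hKx ⊢
    exact ofReal_integral_eq_lintegral_ofReal (.of_integral_ne_zero hKx.ne')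
      ((ae_restrict_mem measurableSet_Ioi).mono fun y hy => hnn hx hy)
  have hmL : AEStronglyMeasurable
      (fun y : ℝ => y ^ (p - 1 / 2) * gigZ (-1 / 2) a (b + 2 * y))
      (volume.restrict (Ioi (0 : ℝ))) := by
    unfold gigZ
    simp_rw [← integral_const_mul]
    exact hm.stronglyMeasurable.integral_prod_right'.aestronglyMeasurable
  have hmR : Measurable fun x : ℝ => Real.Gamma (p + 1 / 2) * gigKernel p a b x := by
    unfold gigKernel
    fun_prop
  rw [gigZ.eq_1 p a b, ← integral_const_mul, integral_eq_lintegral_of_nonneg_ae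
      ((ae_restrict_mem measurableSet_Ioi).mono fun y hy => (hZ hy).le) hmL,
    integral_eq_lintegral_of_nonneg_ae
      ((ae_restrict_mem measurableSet_Ioi).mono fun x hx => (hK hx).le)
      hmR.aestronglyMeasurable,
    setLIntegral_congr_fun measurableSet_Ioi hL, setLIntegral_congr_fun measurableSet_Ioi hR,
    lintegral_lintegral_swap hm.ennreal_ofReal.aemeasurable]

/-- The normalizing constant Z₁ of the mixing density in Proposition 1, case p > -1/2. -/
theorem gig_mixing_normalizer_pos (p a b : ℝ) (hp : -(1/2 : ℝ) < p) (ha : 0 < a) (hb : 0 < b) :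
    ∫ y in Ioi (0 : ℝ),
        y ^ (p - 1/2) * (b + 2 * y) ^ (-(1/2 : ℝ)) * Real.exp (-Real.sqrt (a * (b + 2 * y)))
      = Real.Gamma (p + 1/2) * gigZ p a b / Real.sqrt (2 * Real.pi) := by
  rw [← integral_rpow_mul_gigZ_neg_half hp ha hb, ← integral_div]
  refine setIntegral_congr_fun measurableSet_Ioi fun y hy => ?_
  have hc : 0 < b + 2 * y := by linarith [mem_Ioi.1 hy]
  simp only [gigZ_neg_half ha hc]
  field_simp
end

section
/- Let p > −1/2 and a, b > 0. Set θ = 1/(2a) and μ = (p+1/2)/(2a), fix 0 < c < 1 and α > 0, and let β ≥ α²/(c² a²). Define f(x) = 1 + α(x − θ)² for x > 0 and g(y) = 1 + β(y − μ)² for y > 0, and set k = 1 + α/(4a²) + α b/a + 2 α μ/a. Then for every y > 0, ∫₀^∞ f(x) · f_IG(x; √((b+2y)/a), b+2y) dx ≤ c · g(y) + k. (This is the geometric drift inequality with drift coefficient c < 1 used in the proof of geometric ergodicity of the data-augmented Gibbs sampler for the GIG, case p > −1/2, Proposition 3.) -/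
open Real MeasureTheory Set

open Filter Topology

/-- If `g` has nonnegative derivative on `(a, +∞)` and limits `k` at `a⁺` and `l` at infinity,
then the integral of the derivative on `(a, +∞)` is `l - k`. -/
theorem integral_Ioi_of_hasDerivAt_of_nonneg_of_tendsto {g g' : ℝ → ℝ} {a k l : ℝ}
    (hderiv : ∀ x ∈ Ioi a, HasDerivAt g (g' x) x) (hnonneg : ∀ x ∈ Ioi a, 0 ≤ g' x)
    (hk : Tendsto g (𝓝[>] a) (𝓝 k)) (hl : Tendsto g atTop (𝓝 l)) :
    ∫ x in Ioi a, g' x = l - k := by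
  have h := integral_Ioi_of_hasDerivAt_of_nonneg (g := Function.update g a k) (g' := g')
    (a := a) (l := l) ?_ ?_ hnonneg ?_
  · simpa using h
  · rw [continuousWithinAt_update_same]
    simpa [Ici_sdiff_left] using hk
  · intro x hx
    refine (hderiv x hx).congr_of_eventuallyEq ?_
    filter_upwards [Ioi_mem_nhds hx] with z hz
    exact Function.update_of_ne (ne_of_gt hz) _ _
  · refine hl.congr' ?_
    filter_upwards [Ioi_mem_atTop a] with z hz
    exact (Function.update_of_ne (ne_of_gt hz) _ _).symm

theorem hasDerivAt_integral_exp_neg_mul_sq (b u : ℝ) :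
    HasDerivAt (fun u => ∫ t in (0 : ℝ)..u, exp (-b * t ^ 2)) (exp (-b * u ^ 2)) u :=
  (Continuous.integral_hasStrictDerivAt (by fun_prop) 0 u).hasDerivAt

theorem tendsto_integral_exp_neg_mul_sq_atTop {b : ℝ} (hb : 0 < b) :
    Tendsto (fun u => ∫ t in (0 : ℝ)..u, exp (-b * t ^ 2)) atTop (𝓝 (√(π / b) / 2)) := by
  rw [← integral_gaussian_Ioi]
  exact intervalIntegral_tendsto_integral_Ioi 0 (integrable_exp_neg_mul_sq hb).integrableOn
    tendsto_id

theorem tendsto_integral_exp_neg_mul_sq_atBot {b : ℝ} (hb : 0 < b) :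
    Tendsto (fun u => ∫ t in (0 : ℝ)..u, exp (-b * t ^ 2)) atBot (𝓝 (-(√(π / b) / 2))) := by
  refine ((tendsto_integral_exp_neg_mul_sq_atTop hb).comp tendsto_neg_atBot_atTop).neg.congr ?_
  intro u
  have h := intervalIntegral.integral_comp_neg (a := 0) (b := u) fun t => exp (-b * t ^ 2)
  simp only [neg_sq, neg_zero] at h
  rw [Function.comp_apply, h, intervalIntegral.integral_symm, neg_neg]

theorem tendsto_mul_exp_neg_mul_sq_atTop {b : ℝ} (hb : 0 < b) :
    Tendsto (fun s : ℝ => s * exp (-b * s ^ 2)) atTop (𝓝 0) := by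
  have h := (tendsto_rpow_abs_mul_exp_neg_mul_sq_cocompact hb 1).mono_left atTop_le_cocompact
  refine h.congr' ?_
  filter_upwards [eventually_ge_atTop 0] with s hs
  rw [abs_of_nonneg hs, rpow_one]

theorem mul_exp_neg_mul_sub_div_sq_le {b m s : ℝ} (hb : 0 < b) (hs : 0 < s) :
    s * exp (-b * (s - m / s) ^ 2) ≤ exp (2 * b * m) * (s * exp (-b * s ^ 2)) := by
  have h : -b * (s - m / s) ^ 2 ≤ 2 * b * m + -b * s ^ 2 := by
    have : -b * (s - m / s) ^ 2 = 2 * b * m + -b * s ^ 2 - b * (m / s) ^ 2 := by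
      field_simp
      ring
    have : 0 ≤ b * (m / s) ^ 2 := by positivity
    linarith
  calc s * exp (-b * (s - m / s) ^ 2) ≤ s * exp (2 * b * m + -b * s ^ 2) := by gcongr
    _ = _ := by rw [exp_add]; ring

theorem tendsto_mul_exp_neg_mul_sub_div_sq {b : ℝ} (m : ℝ) (hb : 0 < b) {l : Filter ℝ}
    (hpos : ∀ᶠ s in l, 0 < s) (hl : Tendsto (fun s : ℝ => s * exp (-b * s ^ 2)) l (𝓝 0)) :
    Tendsto (fun s => s * exp (-b * (s - m / s) ^ 2)) l (𝓝 0) := by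
  refine squeeze_zero' ?_ ?_ (mul_zero (exp (2 * b * m)) ▸ hl.const_mul (exp (2 * b * m)))
  · filter_upwards [hpos] with s hs
    positivity
  · filter_upwards [hpos] with s hs
    exact mul_exp_neg_mul_sub_div_sq_le hb hs

/-- Up to a constant factor, an antiderivative of `1 + α (x - 1 / (2a)) ^ 2` times the inverse
Gaussian density with mean `m` and shape `a m ^ 2`, in the variable `s = √x`, when `b = a / 2`,
`C = 1 + α / (4a ^ 2) + α m ^ 2` and `D = 2α / a`. -/
noncomputable def invGaussPrimitive (b m C D s : ℝ) : ℝ :=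
  C / m * ((∫ t in (0 : ℝ)..(s - m / s), exp (-b * t ^ 2)) -
    exp (4 * b * m) * ∫ t in (0 : ℝ)..(s + m / s), exp (-b * t ^ 2)) -
    D * (s * exp (-b * (s - m / s) ^ 2))

theorem hasDerivAt_invGaussPrimitive {b m s : ℝ} (C D : ℝ) (hm : m ≠ 0) (hs : s ≠ 0) :
    HasDerivAt (invGaussPrimitive b m C D)
      ((2 * C / s ^ 2 - D * (1 - 2 * b * (s ^ 2 - m ^ 2 / s ^ 2))) *
        exp (-b * (s - m / s) ^ 2)) s := by
  have hdiv : HasDerivAt (fun s : ℝ => m / s) (-(m / s ^ 2)) s := by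
    simpa [div_eq_mul_inv] using (hasDerivAt_inv hs).const_mul m
  have hu := (hasDerivAt_id s).sub hdiv
  have hv := (hasDerivAt_id s).add hdiv
  have h1 := (hasDerivAt_integral_exp_neg_mul_sq b (s - m / s)).comp s hu
  have h2 := (hasDerivAt_integral_exp_neg_mul_sq b (s + m / s)).comp s hv
  have h3 := (hasDerivAt_id s).mul ((hu.pow 2).const_mul (-b)).exp
  have h := ((h1.sub (h2.const_mul (exp (4 * b * m)))).const_mul (C / m)).sub (h3.const_mul D)
  refine h.congr_deriv ?_
  have he : exp (-b * (s + m / s) ^ 2) = exp (-b * (s - m / s) ^ 2) / exp (4 * b * m) := by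
    rw [← exp_sub]
    congr 1
    field_simp
    ring
  have := exp_ne_zero (4 * b * m)
  simp only [he, id, Pi.sub_apply, Pi.pow_apply, Nat.cast_ofNat, Nat.reduceSub, pow_one]
  generalize exp (-b * (s - m / s) ^ 2) = e
  field_simp
  ring

theorem tendsto_invGaussPrimitive_atTop {b m : ℝ} (C D : ℝ) (hb : 0 < b) :
    Tendsto (invGaussPrimitive b m C D) atTop
      (𝓝 (C / m * (√(π / b) / 2 - exp (4 * b * m) * (√(π / b) / 2)))) := by
  have hdiv : Tendsto (fun s : ℝ => m / s) atTop (𝓝 0) := tendsto_const_nhds.div_atTop tendsto_id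
  have hu : Tendsto (fun s : ℝ => s - m / s) atTop atTop := by
    simpa only [sub_eq_add_neg, id] using tendsto_id.atTop_add hdiv.neg
  have hv : Tendsto (fun s : ℝ => s + m / s) atTop atTop := tendsto_id.atTop_add hdiv
  have hG := tendsto_integral_exp_neg_mul_sq_atTop hb
  have h := (((hG.comp hu).sub ((hG.comp hv).const_mul (exp (4 * b * m)))).const_mul (C / m)).sub
    ((tendsto_mul_exp_neg_mul_sub_div_sq m hb (eventually_gt_atTop 0)
      (tendsto_mul_exp_neg_mul_sq_atTop hb)).const_mul D)
  rw [mul_zero, sub_zero] at h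
  exact h

theorem tendsto_invGaussPrimitive_nhdsGT_zero {b m : ℝ} (C D : ℝ) (hb : 0 < b) (hm : 0 < m) :
    Tendsto (invGaussPrimitive b m C D) (𝓝[>] 0)
      (𝓝 (C / m * (-(√(π / b) / 2) - exp (4 * b * m) * (√(π / b) / 2)))) := by
  have hdiv : Tendsto (fun s : ℝ => m / s) (𝓝[>] 0) atTop :=
    tendsto_inv_nhdsGT_zero.const_mul_atTop hm
  have hid : Tendsto (fun s : ℝ => s) (𝓝[>] 0) (𝓝 0) := tendsto_id.mono_left nhdsWithin_le_nhds
  have hu : Tendsto (fun s : ℝ => s - m / s) (𝓝[>] 0) atBot := by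
    simpa only [sub_eq_add_neg, Function.comp_apply] using hid.add_atBot (tendsto_neg_atTop_atBot.comp hdiv)
  have hv : Tendsto (fun s : ℝ => s + m / s) (𝓝[>] 0) atTop := hid.add_atTop hdiv
  have hz : Tendsto (fun s : ℝ => s * exp (-b * s ^ 2)) (𝓝[>] 0) (𝓝 0) := by
    have hcont : Continuous fun s : ℝ => s * exp (-b * s ^ 2) := by fun_prop
    simpa using (hcont.tendsto 0).mono_left nhdsWithin_le_nhds
  have h := ((((tendsto_integral_exp_neg_mul_sq_atBot hb).comp hu).sub
    (((tendsto_integral_exp_neg_mul_sq_atTop hb).comp hv).const_mul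
      (exp (4 * b * m)))).const_mul (C / m)).sub
    ((tendsto_mul_exp_neg_mul_sub_div_sq m hb self_mem_nhdsWithin hz).const_mul D)
  rw [mul_zero, sub_zero] at h
  exact h

theorem invGaussPdf_eq {a m x : ℝ} (hm : 0 < m) (hx : 0 < x) :
    invGaussPdf m (a * m ^ 2) x =
      √(a * m ^ 2 / (2 * π)) / √x ^ 3 * exp (-(a / 2) * (√x - m / √x) ^ 2) := by
  have hs : 0 < √x := sqrt_pos.2 hx
  unfold invGaussPdf
  congr 1
  · rw [← div_div, sqrt_div' _ (by positivity)]
    congr 1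
    rw [sqrt_eq_iff_mul_self_eq (by positivity) (by positivity)]
    calc x ^ 3 = (√x ^ 2) ^ 3 := by rw [sq_sqrt hx.le]
      _ = √x ^ 3 * √x ^ 3 := by ring
  · congr 1
    nth_rewrite 1 2 [← sq_sqrt hx.le]
    field_simp

/-- The mean of `1 + α (x - 1 / (2a)) ^ 2` under the inverse Gaussian law with mean `m` and
shape `a m ^ 2`. -/
theorem integral_one_add_mul_sub_sq_mul_invGaussPdf {a m α : ℝ} (ha : 0 < a) (hm : 0 < m)
    (hα : 0 ≤ α) :
    ∫ x in Ioi (0 : ℝ), (1 + α * (x - 1 / (2 * a)) ^ 2) * invGaussPdf m (a * m ^ 2) x =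
      1 + α / (4 * a ^ 2) + α * m ^ 2 := by
  set C := 1 + α / (4 * a ^ 2) + α * m ^ 2 with hC
  set K := √(a * m ^ 2 / (2 * π)) with hK
  have hb : 0 < a / 2 := by positivity
  have h0 : Tendsto Real.sqrt (𝓝[>] 0) (𝓝[>] 0) := by
    refine tendsto_nhdsWithin_iff.2 ⟨?_, ?_⟩
    · simpa using (continuous_sqrt.tendsto 0).mono_left nhdsWithin_le_nhds
    · filter_upwards [self_mem_nhdsWithin] with x hx
      exact sqrt_pos.2 hx
  have hderiv : ∀ x ∈ Ioi (0 : ℝ),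
      HasDerivAt (fun x => K * invGaussPrimitive (a / 2) m C (2 * α / a) (√x))
        ((1 + α * (x - 1 / (2 * a)) ^ 2) * invGaussPdf m (a * m ^ 2) x) x := by
    intro x hx
    have hs : 0 < √x := sqrt_pos.2 hx
    have h := ((hasDerivAt_invGaussPrimitive (b := a / 2) C (2 * α / a) hm.ne' hs.ne').comp x
      (hasDerivAt_sqrt (ne_of_gt hx))).const_mul K
    refine h.congr_deriv ?_
    rw [invGaussPdf_eq hm hx, ← hK, hC]
    have hxs : x = √x ^ 2 := (sq_sqrt (le_of_lt hx)).symm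
    generalize √x = s at *
    subst hxs
    generalize exp _ = e
    field_simp
    ring
  rw [integral_Ioi_of_hasDerivAt_of_nonneg_of_tendsto hderiv ?_
    (((tendsto_invGaussPrimitive_nhdsGT_zero C (2 * α / a) hb hm).comp h0).const_mul K)
    (((tendsto_invGaussPrimitive_atTop C (2 * α / a) hb).comp tendsto_sqrt_atTop).const_mul K)]
  · have hKm : K * √(π / (a / 2)) = m := by
      rw [hK, ← sqrt_mul (by positivity)]
      rw [show a * m ^ 2 / (2 * π) * (π / (a / 2)) = m ^ 2 by field_simp]
      exact sqrt_sq hm.le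
    calc _ = C / m * (K * √(π / (a / 2))) := by ring
      _ = C := by rw [hKm]; field_simp
  · intro x _
    unfold invGaussPdf
    positivity

/-- The geometric drift inequality with drift coefficient c < 1 used in the proof of
geometric ergodicity of the data-augmented Gibbs sampler for the GIG
(case p > -1/2, Proposition 3). -/
theorem gig_gibbs_drift_pos (p a b c α β : ℝ) (hp : -(1/2 : ℝ) < p) (ha : 0 < a) (hb : 0 < b)
    (hc0 : 0 < c) (hc1 : c < 1) (hα : 0 < α) (hβ : α ^ 2 / (c ^ 2 * a ^ 2) ≤ β)
    (y : ℝ) (hy : 0 < y) :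
    (∫ x in Ioi (0 : ℝ),
        (1 + α * (x - 1 / (2 * a)) ^ 2) *
          invGaussPdf (Real.sqrt ((b + 2 * y) / a)) (b + 2 * y) x)
      ≤ c * (1 + β * (y - (p + 1/2) / (2 * a)) ^ 2) +
          (1 + α / (4 * a ^ 2) + α * b / a + 2 * α * ((p + 1/2) / (2 * a)) / a) := by
 
  have hlam : 0 < (b + 2 * y) / a := by positivity
  have h := integral_one_add_mul_sub_sq_mul_invGaussPdf ha (sqrt_pos.2 hlam) hα.le
  rw [sq_sqrt hlam.le, mul_div_cancel₀ _ ha.ne'] at h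
  rw [h]
  set t := y - (p + 1 / 2) / (2 * a) with ht
  have hβ' : α ^ 2 / (c * a ^ 2) ≤ c * β := by
    calc α ^ 2 / (c * a ^ 2) = c * (α ^ 2 / (c ^ 2 * a ^ 2)) := by field_simp
      _ ≤ c * β := by gcongr
  have hsq : 2 * α * t / a ≤ c + α ^ 2 / (c * a ^ 2) * t ^ 2 := by
    have : c + α ^ 2 / (c * a ^ 2) * t ^ 2 - 2 * α * t / a = (c - α * t / a) ^ 2 / c := by
      field_simp
      ring
    have : 0 ≤ (c - α * t / a) ^ 2 / c := by positivity
    linarith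
  have hmul := mul_le_mul_of_nonneg_right hβ' (sq_nonneg t)
  have hsplit : α * ((b + 2 * y) / a) =
      α * b / a + 2 * α * ((p + 1 / 2) / (2 * a)) / a + 2 * α * t / a := by
    rw [ht]
    ring
  rw [hsplit]
  linarith
end
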